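/- arXiv:2206.03604 — 6 statements merged into one kernel-verified Lean document; each statement's English description precedes it below -/
import Mathlib

section
/- Let f : ℕ≥1 → ℂ be multiplicative (f(1) = 1 and f(ab) = f(a)f(b) whenever gcd(a,b) = 1) and let s be a real number such that ∑_{m=1}^∞ |f(m)|/m^s < ∞. Then ∑_{m=1}^∞ f(m)²·μ(m)/m^{2s} = (∑_{m=1}^∞ f(m)·μ(m)/m^s) · (∑_{m=1}^∞ f(m)·|μ(m)|/m^s). -/
/-- The Euler product of a summable multiplicative function vanishing at the higher prime powers. -/
theorem hasProd_one_add_of_vanishing_prime_pow {g : ℕ → ℂ} (hg0 : g 0 = 0) (hg1 : g 1 = 1)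
    (hmul : ∀ {m n : ℕ}, m.Coprime n → g (m * n) = g m * g n) (hsum : Summable (‖g ·‖))
    (hpow : ∀ p e : ℕ, p.Prime → 2 ≤ e → g (p ^ e) = 0) :
    HasProd (fun p : Nat.Primes => 1 + g p) (∑' n, g n) := by
  convert EulerProduct.eulerProduct_hasProd hg1 hmul hsum hg0 using 2 with p
  rw [tsum_eq_sum (s := Finset.range 2)]
  · simp [Finset.sum_range_succ, hg1]
  · intro e he
    exact hpow p e p.2 (by simpa [Nat.succ_le_iff] using he)

/-- Euler product for the twist of a multiplicative function by a bounded multiplicative function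
vanishing at the higher prime powers. -/
theorem hasProd_one_add_mul {u : ℕ → ℂ} {c : ℕ → ℤ} (hu0 : u 0 = 0) (hu1 : u 1 = 1)
    (humul : ∀ {m n : ℕ}, m.Coprime n → u (m * n) = u m * u n) (hsum : Summable (‖u ·‖))
    (hc1 : c 1 = 1) (hcmul : ∀ {m n : ℕ}, m.Coprime n → c (m * n) = c m * c n)
    (hc : ∀ n, |c n| ≤ 1) (hpow : ∀ p e : ℕ, p.Prime → 2 ≤ e → c (p ^ e) = 0) :
    HasProd (fun p : Nat.Primes => 1 + u p * c p) (∑' n, u n * c n) := by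
  refine hasProd_one_add_of_vanishing_prime_pow (g := fun n => u n * c n) (by simp [hu0])
    (by simp [hu1, hc1]) ?_ ?_ ?_
  · intro m n h
    simp only [humul h, hcmul h]
    push_cast
    ring
  · refine hsum.of_nonneg_of_le (fun _ => norm_nonneg _) fun n => ?_
    rw [norm_mul, Complex.norm_intCast]
    exact mul_le_of_le_one_right (norm_nonneg _) (by exact_mod_cast hc n)
  · intro p e hp he
    simp [hpow p e hp he]

/-- The Möbius function vanishes at the higher prime powers. -/
theorem moebius_prime_pow_eq_zero {p e : ℕ} (hp : p.Prime) (he : 2 ≤ e) :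
    ArithmeticFunction.moebius (p ^ e) = 0 := by
  rw [ArithmeticFunction.moebius_apply_prime_pow hp (by omega), if_neg (by omega)]

/-- The Euler product identity `∏ (1 - u p ^ 2) = ∏ (1 - u p) * ∏ (1 + u p)` as an identity
between sums twisted by the Möbius function. -/
theorem tsum_sq_mul_moebius {u : ℕ → ℂ} (hu0 : u 0 = 0) (hu1 : u 1 = 1)
    (humul : ∀ {m n : ℕ}, m.Coprime n → u (m * n) = u m * u n) (hsum : Summable (‖u ·‖)) :
    ∑' n, u n ^ 2 * (ArithmeticFunction.moebius n : ℂ) =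
      (∑' n, u n * (ArithmeticFunction.moebius n : ℂ)) *
        ∑' n, u n * ((|ArithmeticFunction.moebius n| : ℤ) : ℂ) := by
  have hcmul {m n : ℕ} (h : m.Coprime n) :=
    ArithmeticFunction.isMultiplicative_moebius.map_mul_of_coprime h
  have hsq : Summable (fun n => ‖u n ^ 2‖) := by
    simpa only [sq, Function.comp_def] using
      (hsum.mul_norm hsum).comp_injective (i := fun n => (n, n)) fun _ _ h => congrArg Prod.fst h
  have hle (n : ℕ) : |ArithmeticFunction.moebius n| ≤ 1 := ArithmeticFunction.abs_moebius_le_one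
  have h₁ := hasProd_one_add_mul hu0 hu1 humul hsum (c := fun n => ArithmeticFunction.moebius n)
    (by simp) hcmul hle fun p e hp he => moebius_prime_pow_eq_zero hp he
  have h₂ := hasProd_one_add_mul hu0 hu1 humul hsum (c := fun n => |ArithmeticFunction.moebius n|)
    (by simp) (fun h => by rw [hcmul h, abs_mul]) (fun n => by rw [abs_abs]; exact hle n)
    fun p e hp he => by simp [moebius_prime_pow_eq_zero hp he]
  have h₃ := hasProd_one_add_mul (u := fun n => u n ^ 2) (by simp [hu0]) (by simp [hu1])
    (fun h => by rw [humul h, mul_pow]) hsq (c := fun n => ArithmeticFunction.moebius n)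
    (by simp) hcmul hle fun p e hp he => moebius_prime_pow_eq_zero hp he
  refine h₃.unique ?_
  convert h₁.mul h₂ using 2 with p
  simp only [ArithmeticFunction.moebius_apply_prime p.2]
  push_cast
  simp
  ring

/-- For `f : ℕ≥1 → ℂ` multiplicative and `s : ℝ` with
`∑_{m=1}^∞ |f(m)|/m^s < ∞`, we have
`∑ f(m)²·μ(m)/m^(2s) = (∑ f(m)·μ(m)/m^s) · (∑ f(m)·|μ(m)|/m^s)`. -/
theorem stmt1 (f : ℕ → ℂ) (hf1 : f 1 = 1)
    (hfmul : ∀ a b : ℕ, 0 < a → 0 < b → Nat.Coprime a b → f (a * b) = f a * f b)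
    (s : ℝ) (hs : Summable fun m : ℕ+ => ‖f (m : ℕ)‖ / ((m : ℕ) : ℝ) ^ s) :
    ∑' m : ℕ+,
        f (m : ℕ) ^ 2 * ((ArithmeticFunction.moebius (m : ℕ) : ℤ) : ℂ) /
          ((((m : ℕ) : ℝ) ^ (2 * s) : ℝ) : ℂ)
      = (∑' m : ℕ+,
            f (m : ℕ) * ((ArithmeticFunction.moebius (m : ℕ) : ℤ) : ℂ) /
              ((((m : ℕ) : ℝ) ^ s : ℝ) : ℂ)) *
        (∑' m : ℕ+,
            f (m : ℕ) * ((|ArithmeticFunction.moebius (m : ℕ)| : ℤ) : ℂ) /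
              ((((m : ℕ) : ℝ) ^ s : ℝ) : ℂ)) := by
  set u : ℕ → ℂ := fun n => if n = 0 then 0 else f n / (((n : ℝ) ^ s : ℝ) : ℂ) with hu
  have hu0 : u 0 = 0 := by simp [hu]
  have hun (m : ℕ+) : u m = f m / ((((m : ℕ) : ℝ) ^ s : ℝ) : ℂ) := by simp [hu]
  have humul {m n : ℕ} (h : m.Coprime n) : u (m * n) = u m * u n := by
    rcases Nat.eq_zero_or_pos m with rfl | hm
    · simp [hu0]
    rcases Nat.eq_zero_or_pos n with rfl | hn
    · simp [hu0]
    simp only [hu, hm.ne', hn.ne', mul_eq_zero, or_self, if_false, hfmul m n hm hn h]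
    rw [Nat.cast_mul, Real.mul_rpow (Nat.cast_nonneg m) (Nat.cast_nonneg n), Complex.ofReal_mul,
      mul_div_mul_comm]
  have hsum : Summable (‖u ·‖) := by
    rw [← summable_pnat_iff_summable_nat]
    refine hs.congr fun m => ?_
    rw [hun, norm_div, Complex.norm_real,
      Real.norm_of_nonneg (Real.rpow_nonneg (Nat.cast_nonneg (m : ℕ)) s)]
  have key := tsum_sq_mul_moebius hu0 (by simp [hu, hf1]) humul hsum
  rw [← tsum_pnat_eq_tsum_of_eq_zero (by simp), ← tsum_pnat_eq_tsum_of_eq_zero (by simp),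
    ← tsum_pnat_eq_tsum_of_eq_zero (by simp)] at key
  simp only [hun, div_pow, ← Complex.ofReal_pow, div_mul_eq_mul_div] at key
  have hrpow (m : ℕ+) : ((m : ℕ) : ℝ) ^ (2 * s) = (((m : ℕ) : ℝ) ^ s) ^ 2 := by
    rw [mul_comm, Real.rpow_mul (Nat.cast_nonneg (m : ℕ)), Real.rpow_two]
  simpa only [hrpow] using key
end

section
/- For every integer n ≥ 2, the Dirichlet series ∑_{m=1}^∞ J_n(m)·μ(m)/m^{2n} converges and equals ζ(2n)·ζ(3n)/(ζ(n)·ζ(6n)). -/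
/-- Jordan totient `J_k(m) = ∑_{d ∣ m} μ(m/d) d^k`. -/
def jordanTotient (k m : ℕ) : ℤ :=
  ∑ d ∈ m.divisors, ArithmeticFunction.moebius (m / d) * (d : ℤ) ^ k

open ArithmeticFunction in
theorem moebius_mul_pow_apply {k : ℕ} (hk : k ≠ 0) (m : ℕ) :
    (moebius * (ArithmeticFunction.pow k : ArithmeticFunction ℤ)) m = jordanTotient k m := by
  rw [mul_apply, Nat.sum_divisorsAntidiagonal'
    fun x y ↦ moebius x * (ArithmeticFunction.pow k : ArithmeticFunction ℤ) y]
  simp [jordanTotient, natCoe_apply, pow_apply, hk]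

theorem isMultiplicative_moebius_mul_pow (k : ℕ) :
    (ArithmeticFunction.moebius *
      (ArithmeticFunction.pow k : ArithmeticFunction ℤ)).IsMultiplicative :=
  ArithmeticFunction.isMultiplicative_moebius.mul
    ArithmeticFunction.isMultiplicative_pow.natCast

theorem jordanTotient_prime {p : ℕ} (k : ℕ) (hp : p.Prime) :
    jordanTotient k p = (p : ℤ) ^ k - 1 := by
  simp [jordanTotient, hp.divisors, Finset.sum_pair hp.one_lt.ne,
    ArithmeticFunction.moebius_apply_prime hp, Nat.div_self hp.pos]
  ring

theorem abs_jordanTotient_le_of_squarefree {k m : ℕ} (hk : k ≠ 0) (hm : Squarefree m) :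
    |jordanTotient k m| ≤ (m : ℤ) ^ k := by
  have hprod : ∏ p ∈ m.primeFactors, jordanTotient k p = jordanTotient k m := by
    simpa only [moebius_mul_pow_apply hk] using
      (isMultiplicative_moebius_mul_pow k).prod_primeFactors hm
  rw [← hprod, Finset.abs_prod]
  calc ∏ p ∈ m.primeFactors, |jordanTotient k p|
      ≤ ∏ p ∈ m.primeFactors, (p : ℤ) ^ k := by
        refine Finset.prod_le_prod (fun _ _ ↦ abs_nonneg _) fun p hp ↦ ?_
        have hp' := Nat.prime_of_mem_primeFactors hp
        have : (1 : ℤ) ≤ (p : ℤ) ^ k := one_le_pow₀ (mod_cast hp'.one_le)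
        rw [jordanTotient_prime k hp', abs_of_nonneg] <;> linarith
    _ = (m : ℤ) ^ k := by
        rw [Finset.prod_pow, ← Nat.cast_prod, Nat.prod_primeFactors_of_squarefree hm]

/-- The terms of the Dirichlet series `∑ J_n(m) μ(m) / m^(2n)`. -/
noncomputable def jordanMoebiusTerm (n m : ℕ) : ℂ :=
  ((jordanTotient n m : ℤ) : ℂ) * ((ArithmeticFunction.moebius m : ℤ) : ℂ) / (m : ℂ) ^ (2 * n)

theorem jordanMoebiusTerm_zero (n : ℕ) : jordanMoebiusTerm n 0 = 0 := by
  simp [jordanMoebiusTerm]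

theorem jordanMoebiusTerm_one (n : ℕ) : jordanMoebiusTerm n 1 = 1 := by
  simp [jordanMoebiusTerm, jordanTotient]

theorem jordanMoebiusTerm_mul {n a b : ℕ} (hn : n ≠ 0) (hab : a.Coprime b) :
    jordanMoebiusTerm n (a * b) = jordanMoebiusTerm n a * jordanMoebiusTerm n b := by
  have hJ := (isMultiplicative_moebius_mul_pow n).map_mul_of_coprime hab
  simp only [moebius_mul_pow_apply hn] at hJ
  simp only [jordanMoebiusTerm, hJ,
    ArithmeticFunction.isMultiplicative_moebius.map_mul_of_coprime hab]
  push_cast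
  rw [mul_pow, div_mul_div_comm]
  ring

theorem norm_jordanMoebiusTerm_le {n : ℕ} (hn : n ≠ 0) (m : ℕ) :
    ‖jordanMoebiusTerm n m‖ ≤ 1 / (m : ℝ) ^ n := by
  by_cases hm : Squarefree m
  · have hm0 : (0 : ℝ) < m := mod_cast Nat.pos_of_ne_zero hm.ne_zero
    have hJ : |(jordanTotient n m : ℝ)| ≤ (m : ℝ) ^ n :=
      mod_cast abs_jordanTotient_le_of_squarefree hn hm
    have hμ : |(ArithmeticFunction.moebius m : ℝ)| ≤ 1 :=
      mod_cast ArithmeticFunction.abs_moebius_le_one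
    simp only [jordanMoebiusTerm, norm_div, norm_mul, norm_pow, Complex.norm_intCast,
      Complex.norm_natCast]
    rw [div_le_div_iff₀ (by positivity) (by positivity), two_mul, pow_add, one_mul]
    gcongr
    simpa using mul_le_mul hJ hμ (abs_nonneg _) (by positivity)
  · simp only [jordanMoebiusTerm, ArithmeticFunction.moebius_eq_zero_of_not_squarefree hm,
      Int.cast_zero, mul_zero, zero_div, norm_zero]
    positivity

theorem summable_norm_jordanMoebiusTerm {n : ℕ} (hn : 2 ≤ n) :
    Summable fun m ↦ ‖jordanMoebiusTerm n m‖ :=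
  .of_nonneg_of_le (fun _ ↦ norm_nonneg _) (norm_jordanMoebiusTerm_le (by omega))
    (Real.summable_one_div_nat_pow.mpr (by omega))

theorem tsum_jordanMoebiusTerm_prime_pow {p : ℕ} (n : ℕ) (hp : p.Prime) :
    ∑' e, jordanMoebiusTerm n (p ^ e) = 1 - ((p : ℂ) ^ n)⁻¹ + ((p : ℂ) ^ n)⁻¹ ^ 2 := by
  have hp0 : (p : ℂ) ≠ 0 := mod_cast hp.ne_zero
  rw [tsum_eq_sum (s := Finset.range 2), Finset.sum_range_succ, Finset.sum_range_one, pow_zero,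
    pow_one, jordanMoebiusTerm_one, jordanMoebiusTerm, jordanTotient_prime n hp,
    ArithmeticFunction.moebius_apply_prime hp]
  · push_cast
    field_simp
    ring
  · intro e he
    have he' : 1 < e := by simpa using he
    rw [jordanMoebiusTerm, ArithmeticFunction.moebius_apply_prime_pow hp (by omega),
      if_neg (by omega)]
    simp

theorem riemannZeta_natCast_eulerProduct_hasProd {k : ℕ} (hk : 1 < k) :
    HasProd (fun p : Nat.Primes ↦ (1 - ((p : ℂ) ^ k)⁻¹)⁻¹) (riemannZeta k) := by
  simpa [Complex.cpow_neg] using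
    riemannZeta_eulerProduct_hasProd (s := k) (by simpa using hk)

theorem tsum_jordanMoebiusTerm {n : ℕ} (hn : 2 ≤ n) :
    ∑' m, jordanMoebiusTerm n m =
      riemannZeta ((2 * n : ℕ) : ℂ) * riemannZeta ((3 * n : ℕ) : ℂ) /
        (riemannZeta (n : ℂ) * riemannZeta ((6 * n : ℕ) : ℂ)) := by
  have hζ {k : ℕ} (hk : 1 < k) : riemannZeta k ≠ 0 :=
    riemannZeta_ne_zero_of_one_lt_re (by simpa using hk)
  have hF : HasProd (fun p : Nat.Primes ↦ ∑' e, jordanMoebiusTerm n (p ^ e))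
      (∑' m, jordanMoebiusTerm n m) :=
    EulerProduct.eulerProduct_hasProd (jordanMoebiusTerm_one n)
      (jordanMoebiusTerm_mul (by omega)) (summable_norm_jordanMoebiusTerm hn)
      (jordanMoebiusTerm_zero n)
  rw [eq_div_iff (mul_ne_zero (hζ (by omega)) (hζ (by omega)))]
  have hL := hF.mul ((riemannZeta_natCast_eulerProduct_hasProd (k := n) (by omega)).mul
    (riemannZeta_natCast_eulerProduct_hasProd (k := 6 * n) (by omega)))
  have hR := (riemannZeta_natCast_eulerProduct_hasProd (k := 2 * n) (by omega)).mul
    (riemannZeta_natCast_eulerProduct_hasProd (k := 3 * n) (by omega))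
  refine hL.unique ?_
  convert hR using 2 with p
  have hx : ‖((p : ℂ) ^ n)⁻¹‖ < 1 := by
    rw [norm_inv, norm_pow, Complex.norm_natCast]
    exact inv_lt_one_of_one_lt₀ (one_lt_pow₀ (mod_cast p.prop.one_lt) (by omega))
  rw [tsum_jordanMoebiusTerm_prime_pow n p.prop]
  simp only [mul_comm _ n, pow_mul, ← inv_pow _ 2, ← inv_pow _ 3, ← inv_pow _ 6]
  generalize ((p : ℂ) ^ n)⁻¹ = x at hx
  have hne {k : ℕ} (hk : k ≠ 0) : 1 - x ^ k ≠ 0 := fun h ↦ by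
    have hk' : ‖x‖ ^ k < 1 := pow_lt_one₀ (norm_nonneg _) hx hk
    rw [← norm_pow, ← sub_eq_zero.mp h, norm_one] at hk'
    exact hk'.false
  have h1 : 1 - x ≠ 0 := by simpa using hne one_ne_zero
  have h2 := hne (k := 2) (by norm_num)
  have h3 := hne (k := 3) (by norm_num)
  have h6 := hne (k := 6) (by norm_num)
  field_simp
  ring

/-- For every integer `n ≥ 2`, the Dirichlet series
`∑_{m=1}^∞ J_n(m)·μ(m)/m^(2n)` converges and equals `ζ(2n)·ζ(3n)/(ζ(n)·ζ(6n))`. -/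
theorem stmt2 (n : ℕ) (hn : 2 ≤ n) :
    HasSum
      (fun m : ℕ+ =>
        ((jordanTotient n (m : ℕ) : ℤ) : ℂ) * ((ArithmeticFunction.moebius (m : ℕ) : ℤ) : ℂ) /
          ((m : ℕ) : ℂ) ^ (2 * n))
      (riemannZeta ((2 * n : ℕ) : ℂ) * riemannZeta ((3 * n : ℕ) : ℂ) /
        (riemannZeta (n : ℂ) * riemannZeta ((6 * n : ℕ) : ℂ))) := by
  rw [← tsum_jordanMoebiusTerm hn]
  refine (PNat.coe_injective.hasSum_iff (f := jordanMoebiusTerm n) fun m hm ↦ ?_).mpr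
    (summable_norm_jordanMoebiusTerm hn).of_norm.hasSum
  obtain rfl : m = 0 := by
    by_contra h
    exact hm ⟨⟨m, Nat.pos_of_ne_zero h⟩, rfl⟩
  exact jordanMoebiusTerm_zero n
end

section
/- For every integer n ≥ 2, ∑_{m=1}^∞ θ(m)·σ_n(m)/m^{2n} = ζ(n)² · ∑_{m=1}^∞ J_n(m)²/m^{4n}. -/
/-- `θ(m) = #{(a,b) ∈ ℕ≥1 × ℕ≥1 : ab = m and gcd(a,b) = 1}`. -/
noncomputable def thetaFn (m : ℕ) : ℕ :=
  Nat.card {p : ℕ+ × ℕ+ // (p.1 : ℕ) * (p.2 : ℕ) = m ∧ Nat.Coprime (p.1 : ℕ) (p.2 : ℕ)}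

theorem thetaFn_eq_card (m : ℕ) :
    thetaFn m = (m.divisors.filter fun d ↦ Nat.Coprime d (m / d)).card := by
  rw [thetaFn, ← Nat.card_eq_finsetCard]
  refine Nat.card_congr
    { toFun := fun p ↦ ⟨(p.1.1 : ℕ), ?_⟩
      invFun := fun d ↦ ⟨(⟨d.1, ?_⟩, ⟨m / d.1, ?_⟩), ?_⟩
      left_inv := ?_
      right_inv := fun d ↦ rfl }
  · obtain ⟨⟨a, b⟩, hab, hc⟩ := p
    simp only at hab hc ⊢
    rw [Finset.mem_filter, Nat.mem_divisors, ← hab, Nat.mul_div_cancel_left _ a.pos]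
    exact ⟨⟨dvd_mul_right _ _, by positivity⟩, hc⟩
  · exact Nat.pos_of_mem_divisors (Finset.mem_filter.1 d.2).1
  · have h := (Finset.mem_filter.1 d.2).1
    exact Nat.div_pos (Nat.divisor_le h) (Nat.pos_of_mem_divisors h)
  · have h := Finset.mem_filter.1 d.2
    exact ⟨Nat.mul_div_cancel' (Nat.dvd_of_mem_divisors h.1), h.2⟩
  · rintro ⟨⟨a, b⟩, hab, hc⟩
    simp only at hab
    refine Subtype.ext (Prod.ext rfl (PNat.eq ?_))
    simp [← hab]

theorem thetaFn_one : thetaFn 1 = 1 := by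
  rw [thetaFn_eq_card]; rfl

theorem thetaFn_mul_of_coprime {m n : ℕ} (h : m.Coprime n) :
    thetaFn (m * n) = thetaFn m * thetaFn n := by
  rw [thetaFn_eq_card, thetaFn_eq_card, thetaFn_eq_card]
  simp only [Finset.card_filter]
  rw [Finset.sum_mul_sum, ← Finset.sum_product', Nat.divisors_mul, Finset.mul_def,
    Finset.sum_image h.mul_injOn_divisors]
  refine Finset.sum_congr rfl fun d hd ↦ ?_
  obtain ⟨a, b⟩ := d
  obtain ⟨ha, hb⟩ := Finset.mem_product.1 hd
  have ha0 := Nat.pos_of_mem_divisors ha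
  have hb0 := Nat.pos_of_mem_divisors hb
  obtain ⟨x, rfl⟩ := Nat.dvd_of_mem_divisors ha
  obtain ⟨y, rfl⟩ := Nat.dvd_of_mem_divisors hb
  dsimp only
  rw [mul_mul_mul_comm, Nat.mul_div_cancel_left _ ha0, Nat.mul_div_cancel_left _ hb0,
    Nat.mul_div_cancel_left _ (mul_pos ha0 hb0), ite_zero_mul_ite_zero, one_mul]
  simp only [Nat.coprime_mul_iff_left, Nat.coprime_mul_iff_right] at h ⊢
  have := h.1.2.symm
  have := h.2.1
  congr 1
  grind [Nat.coprime_comm]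

theorem thetaFn_prime_pow {p : ℕ} (hp : p.Prime) (e : ℕ) : thetaFn (p ^ (e + 1)) = 2 := by
  rw [thetaFn_eq_card, Finset.card_filter,
    Nat.sum_divisors_prime_pow hp, Finset.sum_range_succ, Finset.sum_range_succ']
  rw [Finset.sum_eq_zero]
  · simp [hp.pos]
  · intro k hk
    rw [Finset.mem_range] at hk
    rw [if_neg]
    rw [Nat.pow_div (by omega) hp.pos, Nat.coprime_pow_left_iff (by omega),
      Nat.coprime_pow_right_iff (by omega), Nat.coprime_self]
    exact hp.ne_one

theorem thetaFn_le_card_divisors (m : ℕ) : thetaFn m ≤ m.divisors.card :=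
  thetaFn_eq_card m ▸ Finset.card_filter_le _ _

theorem jordanTotient_eq_moebius_mul_pow {k : ℕ} (hk : k ≠ 0) (m : ℕ) :
    jordanTotient k m =
      (ArithmeticFunction.moebius * (ArithmeticFunction.pow k : ArithmeticFunction ℤ)) m := by
  rw [ArithmeticFunction.mul_apply,
    Nat.sum_divisorsAntidiagonal' fun x y ↦ ArithmeticFunction.moebius x *
      (ArithmeticFunction.pow k : ArithmeticFunction ℤ) y]
  simp [jordanTotient, hk]

theorem jordanTotient_one (k : ℕ) : jordanTotient k 1 = 1 := by
  simp [jordanTotient]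

theorem jordanTotient_mul_of_coprime {k m n : ℕ} (hk : k ≠ 0) (h : m.Coprime n) :
    jordanTotient k (m * n) = jordanTotient k m * jordanTotient k n := by
  simp only [jordanTotient_eq_moebius_mul_pow hk]
  exact (ArithmeticFunction.isMultiplicative_moebius.mul
    ArithmeticFunction.isMultiplicative_pow.natCast).map_mul_of_coprime h

theorem jordanTotient_prime_pow {p : ℕ} (hp : p.Prime) (k e : ℕ) :
    jordanTotient k (p ^ (e + 1)) = (p : ℤ) ^ (k * e) * (p ^ k - 1) := by
  rw [jordanTotient, Nat.sum_divisors_prime_pow hp, Finset.sum_range_succ, Finset.sum_range_succ,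
    Finset.sum_eq_zero]
  · rw [Nat.pow_div (by omega) hp.pos, Nat.pow_div le_rfl hp.pos]
    simp [ArithmeticFunction.moebius_apply_prime hp]
    ring
  · intro i hi
    rw [Finset.mem_range] at hi
    rw [Nat.pow_div (by omega) hp.pos, ArithmeticFunction.moebius_apply_prime_pow hp (by omega),
      if_neg (by omega), zero_mul]

theorem abs_jordanTotient_le_sigma (k m : ℕ) :
    |jordanTotient k m| ≤ ArithmeticFunction.sigma k m := by
  rw [ArithmeticFunction.sigma_apply]
  push_cast
  refine (Finset.abs_sum_le_sum_abs _ _).trans (Finset.sum_le_sum fun d _ ↦ ?_)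
  rw [abs_mul, abs_of_nonneg (by positivity : (0 : ℤ) ≤ (d : ℤ) ^ k)]
  exact mul_le_of_le_one_left (by positivity) ArithmeticFunction.abs_moebius_le_one

theorem sigma_le_tsum_mul_pow {k : ℕ} (hk : 2 ≤ k) (m : ℕ) :
    (ArithmeticFunction.sigma k m : ℝ) ≤ (∑' d : ℕ, ((d : ℝ) ^ k)⁻¹) * (m : ℝ) ^ k := by
  rw [ArithmeticFunction.sigma_eq_sum_div]
  push_cast
  calc ∑ d ∈ m.divisors, (((m / d : ℕ) : ℝ)) ^ k
      = (∑ d ∈ m.divisors, ((d : ℝ) ^ k)⁻¹) * (m : ℝ) ^ k := by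
        rw [Finset.sum_mul]
        refine Finset.sum_congr rfl fun d hd ↦ ?_
        rw [Nat.cast_div (Nat.dvd_of_mem_divisors hd)
          (by exact_mod_cast (Nat.pos_of_mem_divisors hd).ne'), div_pow]
        ring
    _ ≤ _ := by
        gcongr
        exact (Real.summable_nat_pow_inv.2 (by omega)).sum_le_tsum _ fun _ _ ↦ by positivity

theorem summable_card_divisors_div_pow {k : ℕ} (hk : 2 ≤ k) :
    Summable fun m : ℕ ↦ (m.divisors.card : ℝ) / (m : ℝ) ^ k := by
  have hz : LSeriesSummable (fun m ↦ ((ArithmeticFunction.zeta : ArithmeticFunction ℂ) m)) k := by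
    have := ArithmeticFunction.LSeriesSummable_zeta_iff (s := (k : ℂ))
    simp only [ArithmeticFunction.natCoe_apply]
    exact this.2 (by simpa using Nat.lt_of_succ_le hk)
  refine (ArithmeticFunction.LSeriesSummable_mul hz hz).norm.congr fun m ↦ ?_
  rcases eq_or_ne m 0 with rfl | hm
  · simp
  rw [LSeries.term_of_ne_zero hm, ArithmeticFunction.coe_mul_zeta_apply,
    Finset.sum_congr rfl (g := fun _ ↦ (1 : ℂ))]
  · simp
  · intro d hd
    simp [(Nat.pos_of_mem_divisors hd).ne']

theorem summable_thetaFn_mul_sigma {n : ℕ} (hn : 2 ≤ n) :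
    Summable fun m : ℕ ↦ ‖(thetaFn m : ℂ) * (ArithmeticFunction.sigma n m : ℂ) /
      (m : ℂ) ^ (2 * n)‖ := by
  refine Summable.of_nonneg_of_le (fun _ ↦ norm_nonneg _) (fun m ↦ ?_)
    ((summable_card_divisors_div_pow hn).mul_left (∑' d : ℕ, ((d : ℝ) ^ n)⁻¹))
  rcases eq_or_ne m 0 with rfl | hm
  · simp
  have hm' : (0 : ℝ) < m := by positivity
  simp only [norm_div, norm_mul, norm_pow, Complex.norm_natCast]
  calc (thetaFn m : ℝ) * (ArithmeticFunction.sigma n m : ℝ) / (m : ℝ) ^ (2 * n)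
      ≤ (m.divisors.card : ℝ) * ((∑' d : ℕ, ((d : ℝ) ^ n)⁻¹) * (m : ℝ) ^ n) /
          (m : ℝ) ^ (2 * n) := by
        gcongr
        · exact thetaFn_le_card_divisors m
        · exact sigma_le_tsum_mul_pow hn m
    _ = _ := by
        rw [two_mul, pow_add]
        field_simp

theorem summable_jordanTotient_sq {n : ℕ} (hn : 2 ≤ n) :
    Summable fun m : ℕ ↦ ‖(jordanTotient n m : ℂ) ^ 2 / (m : ℂ) ^ (4 * n)‖ := by
  refine Summable.of_nonneg_of_le (fun _ ↦ norm_nonneg _) (fun m ↦ ?_)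
    ((Real.summable_nat_pow_inv (p := 2 * n).2 (by omega)).mul_left
      ((∑' d : ℕ, ((d : ℝ) ^ n)⁻¹) ^ 2))
  rcases eq_or_ne m 0 with rfl | hm
  · simp [show n ≠ 0 by omega]
  have hm' : (0 : ℝ) < m := by positivity
  have hJ : |(jordanTotient n m : ℝ)| ≤ (∑' d : ℕ, ((d : ℝ) ^ n)⁻¹) * (m : ℝ) ^ n :=
    le_trans (by exact_mod_cast abs_jordanTotient_le_sigma n m) (sigma_le_tsum_mul_pow hn m)
  simp only [norm_div, norm_pow, Complex.norm_natCast, Complex.norm_intCast]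
  calc |(jordanTotient n m : ℝ)| ^ 2 / (m : ℝ) ^ (4 * n)
      ≤ ((∑' d : ℕ, ((d : ℝ) ^ n)⁻¹) * (m : ℝ) ^ n) ^ 2 / (m : ℝ) ^ (4 * n) := by gcongr
    _ = _ := by
        rw [show 4 * n = 2 * n + 2 * n by ring, pow_add, mul_pow, ← pow_mul, mul_comm n 2]
        field_simp

theorem tsum_pnat_eq_tsum_nat {f : ℕ → ℂ} (h0 : f 0 = 0) (hf : Summable f) :
    ∑' m : ℕ+, f m = ∑' m : ℕ, f m := by
  rw [← tsum_zero_pnat_eq_tsum_nat hf, h0, zero_add]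

theorem norm_inv_prime_pow_lt_one {p n : ℕ} (hp : p.Prime) (hn : n ≠ 0) :
    ‖((p : ℂ) ^ n)⁻¹‖ < 1 := by
  rw [norm_inv, norm_pow, Complex.norm_natCast]
  exact inv_lt_one_of_one_lt₀ (one_lt_pow₀ (by exact_mod_cast hp.one_lt) hn)

theorem thetaFn_mul_sigma_prime_pow {p n : ℕ} (hp : p.Prime) (hn : n ≠ 0) (e : ℕ) :
    (thetaFn (p ^ (e + 1)) : ℂ) * (ArithmeticFunction.sigma n (p ^ (e + 1)) : ℂ) /
        ((p ^ (e + 1) : ℕ) : ℂ) ^ (2 * n) =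
      2 / (1 - ((p : ℂ) ^ n)⁻¹) * (((p : ℂ) ^ n)⁻¹ * ((p : ℂ) ^ n)⁻¹ ^ e -
        ((p : ℂ) ^ n)⁻¹ ^ 3 * (((p : ℂ) ^ n)⁻¹ ^ 2) ^ e) := by
  have hq0 : (p : ℂ) ^ n ≠ 0 := pow_ne_zero _ (by exact_mod_cast hp.ne_zero)
  have hq1 : (p : ℂ) ^ n ≠ 1 := by
    exact_mod_cast (Nat.one_lt_pow hn hp.one_lt).ne'
  have hs : (ArithmeticFunction.sigma n (p ^ (e + 1)) : ℂ) =
      (((p : ℂ) ^ n) ^ (e + 2) - 1) / ((p : ℂ) ^ n - 1) := by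
    rw [ArithmeticFunction.sigma_apply_prime_pow hp, ← geom_sum_eq hq1]
    push_cast
    exact Finset.sum_congr rfl fun j _ ↦ by rw [← pow_mul, mul_comm]
  have hd : ((p ^ (e + 1) : ℕ) : ℂ) ^ (2 * n) = ((p : ℂ) ^ n) ^ (2 * e + 2) := by
    push_cast
    rw [← pow_mul, ← pow_mul]
    congr 1
    ring
  rw [thetaFn_prime_pow hp, hs, hd]
  generalize (p : ℂ) ^ n = q at *
  have hq1' : q - 1 ≠ 0 := sub_ne_zero.2 hq1
  have : 1 - q⁻¹ = (q - 1) / q := by field_simp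
  rw [this]
  push_cast
  simp only [inv_pow]
  field_simp
  ring

theorem hasSum_thetaFn_mul_sigma_prime_pow {p n : ℕ} (hp : p.Prime) (hn : n ≠ 0) :
    HasSum (fun e : ℕ ↦ (thetaFn (p ^ e) : ℂ) * (ArithmeticFunction.sigma n (p ^ e) : ℂ) /
        ((p ^ e : ℕ) : ℂ) ^ (2 * n))
      ((1 - ((p : ℂ) ^ n)⁻¹)⁻¹ ^ 2 *
        (1 + (1 - ((p : ℂ) ^ n)⁻¹) ^ 2 * ((p : ℂ) ^ n)⁻¹ ^ 2 *
          (1 - ((p : ℂ) ^ n)⁻¹ ^ 2)⁻¹)) := by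
  rw [← hasSum_nat_add_iff' 1]
  simp only [thetaFn_mul_sigma_prime_pow hp hn]
  have ht := norm_inv_prime_pow_lt_one hp hn
  generalize ((p : ℂ) ^ n)⁻¹ = t at *
  have ht2 : ‖t ^ 2‖ < 1 := by
    rw [norm_pow]
    exact pow_lt_one₀ (norm_nonneg _) ht two_ne_zero
  have h1 : 1 - t ≠ 0 := sub_ne_zero.2 fun h ↦ by simp [← h] at ht
  have h2 : 1 - t ^ 2 ≠ 0 := sub_ne_zero.2 fun h ↦ by simp [← h] at ht2
  convert (((hasSum_geometric_of_norm_lt_one ht).mul_left t).sub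
    ((hasSum_geometric_of_norm_lt_one ht2).mul_left (t ^ 3))).mul_left (2 / (1 - t)) using 1
  · rfl
  · simp only [Finset.range_one, Finset.sum_singleton, pow_zero, thetaFn_one,
      ArithmeticFunction.sigma_one, Nat.cast_one, one_pow, mul_one, div_one]
    field_simp
    ring

theorem hasSum_jordanTotient_sq_prime_pow {p n : ℕ} (hp : p.Prime) (hn : n ≠ 0) :
    HasSum (fun e : ℕ ↦ (jordanTotient n (p ^ e) : ℂ) ^ 2 / ((p ^ e : ℕ) : ℂ) ^ (4 * n))
      (1 + (1 - ((p : ℂ) ^ n)⁻¹) ^ 2 * ((p : ℂ) ^ n)⁻¹ ^ 2 *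
        (1 - ((p : ℂ) ^ n)⁻¹ ^ 2)⁻¹) := by
  have ht := norm_inv_prime_pow_lt_one hp hn
  have ht2 : ‖((p : ℂ) ^ n)⁻¹ ^ 2‖ < 1 := by
    rw [norm_pow]
    exact pow_lt_one₀ (norm_nonneg _) ht two_ne_zero
  rw [← hasSum_nat_add_iff' 1]
  convert (hasSum_geometric_of_norm_lt_one ht2).mul_left
    ((1 - ((p : ℂ) ^ n)⁻¹) ^ 2 * ((p : ℂ) ^ n)⁻¹ ^ 2) using 1
  · rfl
  · funext e
    have hq0 : (p : ℂ) ^ n ≠ 0 := pow_ne_zero _ (by exact_mod_cast hp.ne_zero)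
    have hd : ((p ^ (e + 1) : ℕ) : ℂ) ^ (4 * n) = ((p : ℂ) ^ n) ^ (4 * e + 4) := by
      push_cast
      rw [← pow_mul, ← pow_mul]
      congr 1
      ring
    rw [jordanTotient_prime_pow hp, hd]
    push_cast
    rw [pow_mul]
    generalize (p : ℂ) ^ n = q at *
    simp only [inv_pow]
    field_simp
    ring
  · simp [jordanTotient_one]

/-- For every integer `n ≥ 2`,
`∑_{m=1}^∞ θ(m)·σ_n(m)/m^(2n) = ζ(n)² · ∑_{m=1}^∞ J_n(m)²/m^(4n)`. -/
theorem stmt4 (n : ℕ) (hn : 2 ≤ n) :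
    ∑' m : ℕ+,
        (thetaFn (m : ℕ) : ℂ) * ((ArithmeticFunction.sigma n (m : ℕ) : ℕ) : ℂ) /
          ((m : ℕ) : ℂ) ^ (2 * n)
      = riemannZeta (n : ℂ) ^ 2 *
        ∑' m : ℕ+, ((jordanTotient n (m : ℕ) : ℤ) : ℂ) ^ 2 / ((m : ℕ) : ℂ) ^ (4 * n) := by
  have hn0 : n ≠ 0 := by omega
  have hL := summable_thetaFn_mul_sigma hn
  have hR := summable_jordanTotient_sq hn
  rw [tsum_pnat_eq_tsum_nat (f := fun m : ℕ ↦ (thetaFn m : ℂ) *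
      ((ArithmeticFunction.sigma n m : ℕ) : ℂ) / (m : ℂ) ^ (2 * n)) (by simp) hL.of_norm,
    tsum_pnat_eq_tsum_nat (f := fun m : ℕ ↦ (jordanTotient n m : ℂ) ^ 2 / (m : ℂ) ^ (4 * n))
      (by simp [hn0]) hR.of_norm]
  have hPL := EulerProduct.eulerProduct_hasProd (by simp [thetaFn_one]) (fun {a b} hab ↦ by
    rw [thetaFn_mul_of_coprime hab,
      ArithmeticFunction.isMultiplicative_sigma.map_mul_of_coprime hab]
    push_cast
    rw [mul_pow]
    ring) hL (by simp)
  have hPR := EulerProduct.eulerProduct_hasProd (by simp [jordanTotient_one]) (fun {a b} hab ↦ by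
    rw [jordanTotient_mul_of_coprime hn0 hab]
    push_cast
    rw [mul_pow, mul_pow]
    ring) hR (by simp [hn0])
  have hZ := riemannZeta_eulerProduct_hasProd (s := n) (by simpa using Nat.lt_of_succ_le hn)
  have hprod := (hZ.mul hZ).mul hPR
  rw [← sq] at hprod
  refine hPL.unique ?_
  convert hprod using 1
  funext p
  rw [(hasSum_thetaFn_mul_sigma_prime_pow p.2 hn0).tsum_eq,
    (hasSum_jordanTotient_sq_prime_pow p.2 hn0).tsum_eq, Complex.cpow_neg, Complex.cpow_natCast,
    sq]
end

section
/- ∑_{m=1}^∞ λ(m)·τ(m)·σ'_2(m)/m^6 = ζ(4)²·ζ(10)·ζ(12)²/(ζ(6)²·ζ(20)) = 154226363·π^{10}/12741871041900. -/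
/-- Liouville's function `λ(m) = (-1)^Ω(m)`. -/
def liouvilleLambda (m : ℕ) : ℤ := (-1) ^ (ArithmeticFunction.cardFactors m)

/-- `σ'_k(m) = ∑_{d ∣ m} λ(d) d^k`. -/
def sigmaPrime (k m : ℕ) : ℤ := ∑ d ∈ m.divisors, liouvilleLambda d * (d : ℤ) ^ k

theorem bernoulli_values : bernoulli 4 = -1 / 30 ∧ bernoulli 6 = 1 / 42 ∧
    bernoulli 10 = 5 / 66 ∧ bernoulli 12 = -691 / 2730 ∧ bernoulli 20 = -174611 / 330 := by
  have o (n : ℕ) (h : Odd n) (h1 : 1 < n) := bernoulli_eq_zero_of_odd h h1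
  have h3 := o 3 (by decide) (by decide)
  have h5 := o 5 (by decide) (by decide)
  have h7 := o 7 (by decide) (by decide)
  have h9 := o 9 (by decide) (by decide)
  have h11 := o 11 (by decide) (by decide)
  have h13 := o 13 (by decide) (by decide)
  have h15 := o 15 (by decide) (by decide)
  have h17 := o 17 (by decide) (by decide)
  have h19 := o 19 (by decide) (by decide)
  have h2 := bernoulli_two
  have h4 : bernoulli 4 = -1 / 30 := by
    have := sum_bernoulli 5
    norm_num [Finset.sum_range_succ, Nat.choose, *] at this
    linarith
  have h6 : bernoulli 6 = 1 / 42 := by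
    have := sum_bernoulli 7
    norm_num [Finset.sum_range_succ, Nat.choose, *] at this
    linarith
  have h8 : bernoulli 8 = -1 / 30 := by
    have := sum_bernoulli 9
    norm_num [Finset.sum_range_succ, Nat.choose, *] at this
    linarith
  have h10 : bernoulli 10 = 5 / 66 := by
    have := sum_bernoulli 11
    norm_num [Finset.sum_range_succ, Nat.choose, *] at this
    linarith
  have h12 : bernoulli 12 = -691 / 2730 := by
    have := sum_bernoulli 13
    norm_num [Finset.sum_range_succ, Nat.choose, *] at this
    linarith
  have h14 : bernoulli 14 = 7 / 6 := by
    have := sum_bernoulli 15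
    norm_num [Finset.sum_range_succ, Nat.choose, *] at this
    linarith
  have h16 : bernoulli 16 = -3617 / 510 := by
    have := sum_bernoulli 17
    norm_num [Finset.sum_range_succ, Nat.choose, *] at this
    linarith
  have h18 : bernoulli 18 = 43867 / 798 := by
    have := sum_bernoulli 19
    norm_num [Finset.sum_range_succ, Nat.choose, *] at this
    linarith
  have h20 : bernoulli 20 = -174611 / 330 := by
    have := sum_bernoulli 21
    norm_num [Finset.sum_range_succ, Nat.choose, *] at this
    linarith
  exact ⟨h4, h6, h10, h12, h20⟩

theorem zeta_quotient_eq :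
    riemannZeta 4 ^ 2 * riemannZeta 10 * riemannZeta 12 ^ 2 /
        (riemannZeta 6 ^ 2 * riemannZeta 20)
      = 154226363 * (Real.pi : ℂ) ^ 10 / 12741871041900 := by
  obtain ⟨h4, h6, h10, h12, h20⟩ := bernoulli_values
  have z4 := riemannZeta_two_mul_nat (k := 2) (by decide)
  have z6 := riemannZeta_two_mul_nat (k := 3) (by decide)
  have z10 := riemannZeta_two_mul_nat (k := 5) (by decide)
  have z12 := riemannZeta_two_mul_nat (k := 6) (by decide)
  have z20 := riemannZeta_two_mul_nat (k := 10) (by decide)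
  norm_num [h4, h6, h10, h12, h20, Nat.factorial] at z4 z6 z10 z12 z20
  have hpi : (Real.pi : ℂ) ≠ 0 := by exact_mod_cast Real.pi_ne_zero
  rw [z4, z6, z10, z12, z20]
  field_simp
  norm_num

/-- The sum `σ'_k` is multiplicative on coprime arguments. -/
theorem sigmaPrime_mul_of_coprime (k : ℕ) {m n : ℕ} (h : m.Coprime n) :
    sigmaPrime k (m * n) = sigmaPrime k m * sigmaPrime k n := by
  have key : ∀ m : ℕ, sigmaPrime k m =
      ((ArithmeticFunction.liouville.pmul
        ((ArithmeticFunction.pow k : ArithmeticFunction ℕ) : ArithmeticFunction ℤ)) *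
        ((ArithmeticFunction.zeta : ArithmeticFunction ℕ) : ArithmeticFunction ℤ)) m := by
    intro m
    rw [ArithmeticFunction.coe_mul_zeta_apply, sigmaPrime]
    refine Finset.sum_congr rfl fun d hd => ?_
    have hd0 : d ≠ 0 := (Nat.pos_of_mem_divisors hd).ne'
    simp [liouvilleLambda, ArithmeticFunction.liouville_apply hd0, hd0,
      ArithmeticFunction.pow_apply]
  rw [key, key, key]
  exact ((ArithmeticFunction.isMultiplicative_liouville.pmul
    ArithmeticFunction.isMultiplicative_pow.natCast).mul
      ArithmeticFunction.isMultiplicative_zeta.natCast).map_mul_of_coprime h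

theorem liouvilleLambda_mul {m n : ℕ} (hm : m ≠ 0) (hn : n ≠ 0) :
    liouvilleLambda (m * n) = liouvilleLambda m * liouvilleLambda n := by
  simp [liouvilleLambda, ArithmeticFunction.cardFactors_mul hm hn, pow_add]

theorem liouvilleLambda_prime_pow {p : ℕ} (hp : p.Prime) (e : ℕ) :
    liouvilleLambda (p ^ e) = (-1) ^ e := by
  simp [liouvilleLambda, ArithmeticFunction.cardFactors_apply_prime_pow hp]

theorem norm_liouvilleLambda (m : ℕ) : ‖((liouvilleLambda m : ℤ) : ℂ)‖ = 1 := by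
  simp [liouvilleLambda]

theorem norm_sigmaPrime_le (k m : ℕ) :
    ‖((sigmaPrime k m : ℤ) : ℂ)‖ ≤ m * (m : ℝ) ^ k := by
  rw [sigmaPrime, Int.cast_sum]
  calc _ ≤ ∑ d ∈ m.divisors, (m : ℝ) ^ k := by
        refine norm_sum_le_of_le _ fun d hd => ?_
        have : (d : ℝ) ≤ m := by exact_mod_cast Nat.divisor_le hd
        rw [Int.cast_mul, norm_mul, norm_liouvilleLambda, one_mul]
        simpa using pow_le_pow_left₀ (by positivity) this k
    _ = (m.divisors.card : ℝ) * (m : ℝ) ^ k := by simp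
    _ ≤ _ := by
        gcongr
        exact Nat.card_divisors_le_self m

theorem sigmaPrime_prime_pow (k : ℕ) {p : ℕ} (hp : p.Prime) (e : ℕ) :
    sigmaPrime k (p ^ e) = ∑ j ∈ Finset.range (e + 1), (-(p : ℤ) ^ k) ^ j := by
  rw [sigmaPrime, Nat.sum_divisors_prime_pow hp]
  refine Finset.sum_congr rfl fun j _ => ?_
  rw [liouvilleLambda_prime_pow hp, neg_pow ((p : ℤ) ^ k)]
  push_cast
  ring

theorem hasSum_succ_mul_geom_sum {u b : ℂ} (hu : ‖u‖ < 1) (hbu : ‖b * u‖ < 1) (hb : b ≠ 1) :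
    HasSum (fun e : ℕ => ((e : ℂ) + 1) * (∑ j ∈ Finset.range (e + 1), b ^ j) * u ^ e)
      ((1 - b * u ^ 2) / ((1 - u) ^ 2 * (1 - b * u) ^ 2)) := by
  have h1 := hasSum_choose_mul_geometric_of_norm_lt_one 1 hu
  have h2 := hasSum_choose_mul_geometric_of_norm_lt_one 1 hbu
  have hb' : b - 1 ≠ 0 := sub_ne_zero.mpr hb
  have hu' : 1 - u ≠ 0 := by
    intro h
    rw [← sub_eq_zero.mp h] at hu
    simp at hu
  have hbu' : 1 - b * u ≠ 0 := by
    intro h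
    rw [← sub_eq_zero.mp h] at hbu
    simp at hbu
  convert! ((h2.mul_left b).sub h1).mul_left (b - 1)⁻¹ using 1
  · funext e
    rw [geom_sum_eq hb]
    simp only [Nat.choose_one_right]
    push_cast
    field_simp
    ring
  · field_simp
    ring

/-- The summand `λ(m) τ(m) σ'_2(m) / m^6` as a function on `ℕ`. -/
noncomputable def liouvilleTauSigmaTerm (m : ℕ) : ℂ :=
  ((liouvilleLambda m : ℤ) : ℂ) * (m.divisors.card : ℂ) * ((sigmaPrime 2 m : ℤ) : ℂ) / (m : ℂ) ^ 6

theorem liouvilleTauSigmaTerm_zero : liouvilleTauSigmaTerm 0 = 0 := by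
  simp [liouvilleTauSigmaTerm]

theorem liouvilleTauSigmaTerm_one : liouvilleTauSigmaTerm 1 = 1 := by
  simp [liouvilleTauSigmaTerm, sigmaPrime, liouvilleLambda]

theorem liouvilleTauSigmaTerm_mul {m n : ℕ} (h : m.Coprime n) :
    liouvilleTauSigmaTerm (m * n) = liouvilleTauSigmaTerm m * liouvilleTauSigmaTerm n := by
  rcases eq_or_ne m 0 with rfl | hm
  · simp [liouvilleTauSigmaTerm_zero]
  rcases eq_or_ne n 0 with rfl | hn
  · simp [liouvilleTauSigmaTerm_zero]
  rw [liouvilleTauSigmaTerm, liouvilleLambda_mul hm hn, sigmaPrime_mul_of_coprime 2 h,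
    h.card_divisors_mul, liouvilleTauSigmaTerm, liouvilleTauSigmaTerm]
  push_cast
  ring

theorem summable_norm_liouvilleTauSigmaTerm : Summable (‖liouvilleTauSigmaTerm ·‖) := by
  refine Summable.of_nonneg_of_le (fun _ => norm_nonneg _) (fun m => ?_)
    (Real.summable_one_div_nat_pow.mpr (one_lt_two))
  rcases eq_or_ne m 0 with rfl | hm
  · simp [liouvilleTauSigmaTerm_zero]
  have hm' : (0 : ℝ) < m := by positivity
  rw [liouvilleTauSigmaTerm, norm_div, norm_mul, norm_mul, norm_liouvilleLambda, one_mul,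
    norm_pow, Complex.norm_natCast, Complex.norm_natCast]
  have h1 : (m.divisors.card : ℝ) ≤ m := by exact_mod_cast Nat.card_divisors_le_self m
  calc _ ≤ (m : ℝ) * (m * (m : ℝ) ^ 2) / (m : ℝ) ^ 6 := by
        gcongr
        exact norm_sigmaPrime_le 2 m
    _ = _ := by field_simp

theorem tsum_liouvilleTauSigmaTerm_prime_pow {p : ℕ} (hp : p.Prime) :
    ∑' e, liouvilleTauSigmaTerm (p ^ e) =
      (1 + ((p : ℂ) ^ 10)⁻¹) /
        ((1 + ((p : ℂ) ^ 6)⁻¹) ^ 2 * (1 - ((p : ℂ) ^ 4)⁻¹) ^ 2) := by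
  have hp0 : (p : ℂ) ≠ 0 := by exact_mod_cast hp.ne_zero
  have hp1 : (1 : ℝ) < p := by exact_mod_cast hp.one_lt
  have hlt : ∀ k : ℕ, k ≠ 0 → ((p : ℝ) ^ k)⁻¹ < 1 := fun k hk =>
    inv_lt_one_of_one_lt₀ (one_lt_pow₀ hp1 hk)
  have hbu : -(p : ℂ) ^ 2 * -((p : ℂ) ^ 6)⁻¹ = ((p : ℂ) ^ 4)⁻¹ := by field_simp
  have h := hasSum_succ_mul_geom_sum (u := -((p : ℂ) ^ 6)⁻¹) (b := -(p : ℂ) ^ 2)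
    (by simpa using hlt 6 (by decide)) (by rw [hbu]; simpa using hlt 4 (by decide)) (by
      intro h
      have : (-(p : ℤ) ^ 2) = 1 := by exact_mod_cast h
      nlinarith [sq_nonneg (p : ℤ)])
  rw [hbu] at h
  convert h.tsum_eq using 1
  · refine tsum_congr fun e => ?_
    rw [liouvilleTauSigmaTerm, liouvilleLambda_prime_pow hp, sigmaPrime_prime_pow 2 hp,
      Nat.divisors_prime_pow hp, Finset.card_map, Finset.card_range, neg_pow ((p : ℂ) ^ 6)⁻¹]
    push_cast
    rw [inv_pow, ← pow_mul, ← pow_mul, mul_comm 6 e]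
    ring
  · congr 1
    · field_simp
      ring
    · ring

theorem hasProd_riemannZeta_nat (k : ℕ) (hk : 1 < k) :
    HasProd (fun p : Nat.Primes => (1 - ((p : ℂ) ^ k)⁻¹)⁻¹) (riemannZeta k) := by
  have := riemannZeta_eulerProduct_hasProd (s := k) (by simpa using hk)
  simpa [Complex.cpow_neg] using this

theorem tsum_liouvilleTauSigmaTerm :
    ∑' m, liouvilleTauSigmaTerm m = riemannZeta 4 ^ 2 * riemannZeta 10 * riemannZeta 12 ^ 2 /
          (riemannZeta 6 ^ 2 * riemannZeta 20) := by
  have h := EulerProduct.eulerProduct_hasProd liouvilleTauSigmaTerm_one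
    (fun h => liouvilleTauSigmaTerm_mul h) summable_norm_liouvilleTauSigmaTerm
    liouvilleTauSigmaTerm_zero
  have z4 := hasProd_riemannZeta_nat 4 (by decide)
  have z6 := hasProd_riemannZeta_nat 6 (by decide)
  have z10 := hasProd_riemannZeta_nat 10 (by decide)
  have z12 := hasProd_riemannZeta_nat 12 (by decide)
  have z20 := hasProd_riemannZeta_nat 20 (by decide)
  push_cast at z4 z6 z10 z12 z20
  have n6 : riemannZeta 6 ≠ 0 := riemannZeta_ne_zero_of_one_lt_re (by norm_num)
  have n20 : riemannZeta 20 ≠ 0 := riemannZeta_ne_zero_of_one_lt_re (by norm_num)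
  rw [eq_div_iff (mul_ne_zero (pow_ne_zero 2 n6) n20)]
  have hL := h.mul (((z6.mul z6).mul z20))
  have hR := ((z4.mul z4).mul z10).mul (z12.mul z12)
  have heq := hL.unique (by
    convert hR using 2 with p
    rw [tsum_liouvilleTauSigmaTerm_prime_pow p.prop]
    have hp1 : (1 : ℝ) < (p : ℕ) := by exact_mod_cast p.prop.one_lt
    have hne : ∀ k : ℕ, k ≠ 0 → ∀ c : ℂ, ‖c‖ = 1 → 1 - c * (((p : ℕ) : ℂ) ^ k)⁻¹ ≠ 0 := by
      intro k hk c hc h0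
      have h1 := congrArg norm (sub_eq_zero.mp h0)
      rw [norm_mul, hc, norm_inv, norm_pow, Complex.norm_natCast, norm_one, one_mul] at h1
      exact (inv_lt_one_of_one_lt₀ (one_lt_pow₀ hp1 hk)).ne' h1
    have m4 := hne 4 (by decide) 1 (by simp)
    have m6 := hne 6 (by decide) 1 (by simp)
    have m10 := hne 10 (by decide) 1 (by simp)
    have p6 := hne 6 (by decide) (-1) (by simp)
    have p10 := hne 10 (by decide) (-1) (by simp)
    simp only [one_mul, neg_mul, sub_neg_eq_add] at m4 m6 m10 p6 p10
    have e12 : 1 - (((p : ℕ) : ℂ) ^ 12)⁻¹ =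
        (1 - (((p : ℕ) : ℂ) ^ 6)⁻¹) * (1 + (((p : ℕ) : ℂ) ^ 6)⁻¹) := by ring
    have e20 : 1 - (((p : ℕ) : ℂ) ^ 20)⁻¹ =
        (1 - (((p : ℕ) : ℂ) ^ 10)⁻¹) * (1 + (((p : ℕ) : ℂ) ^ 10)⁻¹) := by ring
    rw [e12, e20]
    generalize (((p : ℕ) : ℂ) ^ 4)⁻¹ = x at *
    generalize (((p : ℕ) : ℂ) ^ 6)⁻¹ = y at *
    generalize (((p : ℕ) : ℂ) ^ 10)⁻¹ = z at *
    field_simp)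
  linear_combination heq

/-- `∑_{m=1}^∞ λ(m)·τ(m)·σ'_2(m)/m^6
= ζ(4)²·ζ(10)·ζ(12)²/(ζ(6)²·ζ(20)) = 154226363·π^10/12741871041900`. -/
theorem stmt13 :
    (∑' m : ℕ+,
        ((liouvilleLambda (m : ℕ) : ℤ) : ℂ) * ((m : ℕ).divisors.card : ℂ) *
            ((sigmaPrime 2 (m : ℕ) : ℤ) : ℂ) / ((m : ℕ) : ℂ) ^ 6
      = riemannZeta 4 ^ 2 * riemannZeta 10 * riemannZeta 12 ^ 2 /
          (riemannZeta 6 ^ 2 * riemannZeta 20)) ∧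
    riemannZeta 4 ^ 2 * riemannZeta 10 * riemannZeta 12 ^ 2 /
        (riemannZeta 6 ^ 2 * riemannZeta 20)
      = 154226363 * (Real.pi : ℂ) ^ 10 / 12741871041900 := by
  refine ⟨?_, zeta_quotient_eq⟩
  rw [← tsum_liouvilleTauSigmaTerm]
  rw [summable_norm_liouvilleTauSigmaTerm.of_norm.tsum_eq_zero_add, liouvilleTauSigmaTerm_zero,
    zero_add]
  exact tsum_pnat_eq_tsum_succ (f := liouvilleTauSigmaTerm)
end

section
/- For all integers k ≥ 1 and n ≥ k + 2, ∑_{m=1}^∞ τ(m)·σ_k(m)/m^n = ζ(n−k)²·ζ(n)²/ζ(2n−k). -/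
/-- The Dirichlet series of the divisor-counting function converges absolutely on `1 < s.re`. -/
lemma LSeriesSummable_card_divisors {s : ℂ} (hs : 1 < s.re) :
    LSeriesSummable (fun m : ℕ ↦ (m.divisors.card : ℂ)) s := by
  have h := LSeriesSummable_one_iff.mpr hs
  have h2 := h.convolution h
  convert h2 using 1
  funext m
  simp [LSeries.convolution_def, ← Nat.map_div_right_divisors]

lemma Nat.card_divisors_mul_le (a b : ℕ) :
    (a * b).divisors.card ≤ a.divisors.card * b.divisors.card := by
  open scoped Pointwise in
  rw [Nat.divisors_mul]
  exact Finset.card_mul_le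

/-- `τ(m) σ_k(m)` is at most the Dirichlet convolution of `d ↦ τ(d) d ^ k` with `τ`. -/
lemma card_divisors_mul_sigma_le (k m : ℕ) :
    m.divisors.card * ArithmeticFunction.sigma k m ≤
      ∑ p ∈ m.divisorsAntidiagonal, p.1.divisors.card * p.1 ^ k * p.2.divisors.card := by
  rw [ArithmeticFunction.sigma_apply, Finset.mul_sum,
    ← Nat.sum_divisorsAntidiagonal (fun d _ ↦ m.divisors.card * d ^ k)]
  refine Finset.sum_le_sum fun p hp ↦ ?_
  rw [← (Nat.mem_divisorsAntidiagonal.mp hp).1]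
  calc _ ≤ p.1.divisors.card * p.2.divisors.card * p.1 ^ k := by
        gcongr; exact Nat.card_divisors_mul_le _ _
    _ = _ := by ring

lemma summable_norm_card_divisors_mul_sigma_div_pow {k n : ℕ} (hn : k + 2 ≤ n) :
    Summable fun m : ℕ ↦
      ‖(m.divisors.card : ℂ) * ((ArithmeticFunction.sigma k m : ℕ) : ℂ) / (m : ℂ) ^ n‖ := by
  have h1 : LSeriesSummable (fun m : ℕ ↦ (m.divisors.card : ℂ)) (n : ℂ) :=
    LSeriesSummable_card_divisors (by simp; lia)
  have h2 : LSeriesSummable (fun m : ℕ ↦ (m.divisors.card : ℂ) * (m : ℂ) ^ k) (n : ℂ) := by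
    have h : LSeriesSummable (fun m : ℕ ↦ (m.divisors.card : ℂ)) ((n - k : ℕ) : ℂ) :=
      LSeriesSummable_card_divisors (by rw [Complex.natCast_re]; norm_cast; lia)
    refine h.congr fun m ↦ ?_
    rcases eq_or_ne m 0 with rfl | hm
    · simp
    have hm' : (m : ℂ) ≠ 0 := mod_cast hm
    rw [LSeries.term_of_ne_zero hm, LSeries.term_of_ne_zero hm, Complex.cpow_natCast,
      Complex.cpow_natCast, div_eq_div_iff (by positivity) (by positivity)]
    conv_lhs => rw [show n = (n - k) + k by lia]
    rw [pow_add]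
    ring
  refine (h2.convolution h1).norm.of_nonneg_of_le (fun _ ↦ norm_nonneg _) fun m ↦ ?_
  rcases eq_or_ne m 0 with rfl | hm
  · simp
  rw [LSeries.term_of_ne_zero hm, Complex.cpow_natCast, norm_div, norm_div]
  gcongr
  have h := card_divisors_mul_sigma_le k m
  have e : LSeries.convolution (fun m : ℕ ↦ (m.divisors.card : ℂ) * (m : ℂ) ^ k)
      (fun m : ℕ ↦ (m.divisors.card : ℂ)) m = ((∑ p ∈ m.divisorsAntidiagonal,
        p.1.divisors.card * p.1 ^ k * p.2.divisors.card : ℕ) : ℂ) := by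
    simp [LSeries.convolution_def]
  rw [e, ← Nat.cast_mul, Complex.norm_natCast, Complex.norm_natCast]
  exact_mod_cast h

lemma tsum_succ_mul_geom_sum₂ {x y : ℂ} (hx : ‖x‖ < 1) (hy : ‖y‖ < 1) (hxy : x ≠ y) :
    ∑' e : ℕ, ((e : ℂ) + 1) * ((x ^ (e + 1) - y ^ (e + 1)) / (x - y)) =
      (1 - x * y) / ((1 - x) ^ 2 * (1 - y) ^ 2) := by
  have ne {z : ℂ} (hz : ‖z‖ < 1) : 1 - z ≠ 0 := by
    rw [sub_ne_zero]; rintro rfl; simp at hz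
  have key {z : ℂ} (hz : ‖z‖ < 1) :
      HasSum (fun e : ℕ ↦ ((e : ℂ) + 1) * z ^ (e + 1)) (z / (1 - z) ^ 2) := by
    have h := hasSum_coe_mul_geometric_of_norm_lt_one hz
    rw [← hasSum_nat_add_iff' 1] at h
    simpa using h
  have h := ((key hx).sub (key hy)).div_const (x - y)
  have hx' := ne hx
  have hy' := ne hy
  have hd : x - y ≠ 0 := sub_ne_zero.mpr hxy
  rw [show (1 - x * y) / ((1 - x) ^ 2 * (1 - y) ^ 2) =
    (x / (1 - x) ^ 2 - y / (1 - y) ^ 2) / (x - y) by field_simp; ring]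
  rw [← h.tsum_eq]
  exact tsum_congr fun e ↦ by ring

lemma tsum_prime_pow_card_divisors_mul_sigma {k n p : ℕ} (hk : 1 ≤ k) (hn : k + 2 ≤ n)
    (hp : p.Prime) :
    ∑' e : ℕ, (((p ^ e).divisors.card : ℂ) * ((ArithmeticFunction.sigma k (p ^ e) : ℕ) : ℂ) /
        ((p ^ e : ℕ) : ℂ) ^ n) =
      (1 - ((p : ℂ) ^ (2 * n - k))⁻¹) /
        ((1 - ((p : ℂ) ^ (n - k))⁻¹) ^ 2 * (1 - ((p : ℂ) ^ n)⁻¹) ^ 2) := by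
  have hp0 : (p : ℂ) ≠ 0 := mod_cast hp.ne_zero
  have norm_lt {j : ℕ} (hj : j ≠ 0) : ‖((p : ℂ) ^ j)⁻¹‖ < 1 := by
    rw [norm_inv, norm_pow, Complex.norm_natCast]
    exact inv_lt_one_of_one_lt₀ (one_lt_pow₀ (mod_cast hp.one_lt) hj)
  have hne : ((p : ℂ) ^ (n - k))⁻¹ ≠ ((p : ℂ) ^ n)⁻¹ := by
    intro h
    have h' : p ^ (n - k) = p ^ n := by exact_mod_cast inv_injective h
    have := Nat.pow_right_injective hp.two_le h'
    lia
  have hprod : ((p : ℂ) ^ (2 * n - k))⁻¹ = ((p : ℂ) ^ (n - k))⁻¹ * ((p : ℂ) ^ n)⁻¹ := by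
    rw [← mul_inv, ← pow_add]; congr 2; lia
  rw [hprod, ← tsum_succ_mul_geom_sum₂ (norm_lt (by lia)) (norm_lt (by lia)) hne]
  refine tsum_congr fun e ↦ ?_
  have hx : ((p : ℂ) ^ (n - k))⁻¹ = (p : ℂ) ^ k * ((p : ℂ) ^ n)⁻¹ := by
    rw [show (p : ℂ) ^ n = (p : ℂ) ^ (n - k) * (p : ℂ) ^ k by rw [← pow_add]; congr 1; lia]
    field_simp
  rw [← Commute.geom_sum₂ (Commute.all _ _) hne, ArithmeticFunction.sigma_apply_prime_pow hp,
    Nat.divisors_prime_pow hp, Finset.card_map, Finset.card_range, mul_div_assoc]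
  push_cast
  congr 1
  rw [Finset.sum_div]
  refine Finset.sum_congr rfl fun i hi ↦ ?_
  rw [hx, mul_pow, mul_assoc, ← pow_add,
    show i + (e - i) = e by have := Finset.mem_range.mp hi; lia]
  rw [inv_pow, div_eq_mul_inv]
  ring

lemma hasProd_riemannZeta_natCast {j : ℕ} (hj : 2 ≤ j) :
    HasProd (fun p : Nat.Primes ↦ (1 - (((p : ℕ) : ℂ) ^ j)⁻¹)⁻¹) (riemannZeta (j : ℂ)) := by
  have h := riemannZeta_eulerProduct_hasProd (s := (j : ℂ)) (by simp; lia)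
  simpa only [Complex.cpow_neg, Complex.cpow_natCast] using h

/-- For all integers `k ≥ 1` and `n ≥ k + 2`,
`∑_{m=1}^∞ τ(m)·σ_k(m)/m^n = ζ(n−k)²·ζ(n)²/ζ(2n−k)`. -/
theorem stmt15 (k n : ℕ) (hk : 1 ≤ k) (hn : k + 2 ≤ n) :
    ∑' m : ℕ+,
        ((m : ℕ).divisors.card : ℂ) * ((ArithmeticFunction.sigma k (m : ℕ) : ℕ) : ℂ) /
          ((m : ℕ) : ℂ) ^ n
      = riemannZeta ((n - k : ℕ) : ℂ) ^ 2 * riemannZeta (n : ℂ) ^ 2 /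
          riemannZeta ((2 * n - k : ℕ) : ℂ) := by
  let f : ℕ → ℂ := fun m ↦
    (m.divisors.card : ℂ) * ((ArithmeticFunction.sigma k m : ℕ) : ℂ) / (m : ℂ) ^ n
  have hf0 : f 0 = 0 := by simp [f]
  have hf1 : f 1 = 1 := by simp [f]
  have hmul {a b : ℕ} (hab : a.Coprime b) : f (a * b) = f a * f b := by
    simp only [f]
    rw [hab.card_divisors_mul, ArithmeticFunction.isMultiplicative_sigma.map_mul_of_coprime hab]
    push_cast
    rw [mul_pow]
    ring
  have hE := EulerProduct.eulerProduct_hasProd hf1 hmul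
    (summable_norm_card_divisors_mul_sigma_div_pow hn) hf0
  have hsum : ∑' m : ℕ+, f m = ∑' m : ℕ, f m :=
    tsum_subtype_eq_of_support_subset (s := {m : ℕ | 0 < m}) fun m hm ↦
      Nat.pos_of_ne_zero fun h ↦ hm (h ▸ hf0)
  have hz : riemannZeta ((2 * n - k : ℕ) : ℂ) ≠ 0 :=
    riemannZeta_ne_zero_of_one_lt_re (by rw [Complex.natCast_re]; norm_cast; lia)
  have h1 := hasProd_riemannZeta_natCast (j := n - k) (by lia)
  have h2 := hasProd_riemannZeta_natCast (j := n) (by lia)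
  have h3 := hasProd_riemannZeta_natCast (j := 2 * n - k) (by lia)
  have hR := ((h1.mul h1).mul (h2.mul h2)).div₀ h3 hz
  rw [sq, sq]
  refine hsum.trans (hE.unique (hR.congr_fun fun p ↦ ?_))
  rw [tsum_prime_pow_card_divisors_mul_sigma hk hn p.prop]
  simp only [div_eq_mul_inv, mul_inv, inv_inv, sq]
  ring
end

section
/- For all integers k ≥ 1, ℓ ≥ 1 and n ≥ k + 2, ∑_{m=1}^∞ J_k(m^ℓ)/m^{nℓ} = ζ((n−k)ℓ)/ζ((n−k)ℓ + k). -/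
theorem jordanTotient_eq_sum_moebius_mul (k m : ℕ) :
    jordanTotient k m =
      ∑ d ∈ m.divisors, ArithmeticFunction.moebius d * ((m / d : ℕ) : ℤ) ^ k := by
  rw [jordanTotient, ← Nat.sum_div_divisors m]
  refine Finset.sum_congr rfl fun d hd ↦ ?_
  obtain ⟨hdm, hm⟩ := Nat.mem_divisors.mp hd
  rw [Nat.div_div_self hdm hm]

theorem jordanTotient_pow_succ (k m l : ℕ) :
    jordanTotient k (m ^ (l + 1)) = (m : ℤ) ^ (l * k) * jordanTotient k m := by
  rcases eq_or_ne m 0 with rfl | hm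
  · simp [jordanTotient]
  rw [jordanTotient_eq_sum_moebius_mul, jordanTotient_eq_sum_moebius_mul, Finset.mul_sum]
  symm
  refine Finset.sum_subset_zero_on_sdiff
    (Nat.divisors_subset_of_dvd (pow_ne_zero _ hm) (dvd_pow_self m l.succ_ne_zero))
    (fun d hd ↦ ?_) fun d hd ↦ ?_
  · rw [Finset.mem_sdiff, Nat.mem_divisors, Nat.mem_divisors] at hd
    rw [ArithmeticFunction.moebius_eq_zero_of_not_squarefree, zero_mul]
    exact fun hsq ↦ hd.2 ⟨(hsq.dvd_pow_iff_dvd l.succ_ne_zero).mp hd.1.1, hm⟩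
  · rw [pow_succ, Nat.mul_div_assoc _ (Nat.dvd_of_mem_divisors hd)]
    push_cast
    ring

theorem LSeries_jordanTotient {k : ℕ} {s : ℂ} (hs : 1 < s.re) :
    LSeries (fun m ↦ (jordanTotient k m : ℂ)) (s + k) =
      riemannZeta s / riemannZeta (s + k) := by
  have hs' : 1 < (s + k).re := by
    rw [Complex.add_re, Complex.natCast_re]
    have : (0 : ℝ) ≤ k := k.cast_nonneg
    linarith
  have hterm : LSeries.term (fun m ↦ (m : ℂ) ^ k) (s + k) = LSeries.term 1 s := by
    ext m
    rcases eq_or_ne m 0 with rfl | hm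
    · simp
    · have hm' : (m : ℂ) ≠ 0 := Nat.cast_ne_zero.mpr hm
      rw [LSeries.term_of_ne_zero hm, LSeries.term_of_ne_zero hm, Complex.cpow_add _ _ hm',
        Complex.cpow_natCast, Pi.one_apply, mul_comm, div_mul_cancel_left₀ (pow_ne_zero _ hm'),
        one_div]
  have hpow : LSeriesHasSum (fun m ↦ (m : ℂ) ^ k) (s + k) (riemannZeta s) := by
    rw [LSeriesHasSum, hterm]
    exact LSeriesHasSum_one hs
  have hconv : (fun m ↦ (jordanTotient k m : ℂ)) =
      LSeries.convolution (fun m ↦ (ArithmeticFunction.moebius m : ℂ)) fun m ↦ (m : ℂ) ^ k := by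
    ext m
    simp only [LSeries.convolution_def]
    rw [Nat.sum_divisorsAntidiagonal
      (f := fun a b ↦ (ArithmeticFunction.moebius a : ℂ) * (b : ℂ) ^ k),
      jordanTotient_eq_sum_moebius_mul]
    push_cast
    rfl
  have hmoebius := LSeries_one_mul_Lseries_moebius hs'
  rw [LSeries_one_eq_riemannZeta hs'] at hmoebius
  rw [hconv, LSeries_convolution' (ArithmeticFunction.LSeriesSummable_moebius_iff.mpr hs')
    hpow.LSeriesSummable, hpow.LSeries_eq, eq_div_iff (left_ne_zero_of_mul_eq_one hmoebius)]
  linear_combination riemannZeta s * hmoebius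

/-- For all integers `k ≥ 1`, `ℓ ≥ 1` and `n ≥ k + 2`,
`∑_{m=1}^∞ J_k(m^ℓ)/m^(nℓ) = ζ((n−k)ℓ)/ζ((n−k)ℓ + k)`. -/
theorem stmt19 (k l n : ℕ) (hk : 1 ≤ k) (hl : 1 ≤ l) (hn : k + 2 ≤ n) :
    ∑' m : ℕ+, ((jordanTotient k ((m : ℕ) ^ l) : ℤ) : ℂ) / ((m : ℕ) : ℂ) ^ (n * l)
      = riemannZeta (((n - k) * l : ℕ) : ℂ) /
          riemannZeta (((n - k) * l + k : ℕ) : ℂ) := by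
  have hlt : 1 < (n - k) * l := by
    have : 2 ≤ n - k := by lia
    nlinarith
  have hs : 1 < (((n - k) * l : ℕ) : ℂ).re := by
    rw [Complex.natCast_re]
    exact_mod_cast hlt
  rw [Nat.cast_add, ← LSeries_jordanTotient hs, LSeries, ← PNat.coe_injective.tsum_eq]
  · refine tsum_congr fun m ↦ ?_
    have hm : ((m : ℕ) : ℂ) ≠ 0 := Nat.cast_ne_zero.mpr m.ne_zero
    obtain ⟨j, rfl⟩ := Nat.exists_eq_add_of_le' hl
    obtain ⟨c, rfl⟩ := Nat.exists_eq_add_of_le (show k ≤ n by lia)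
    rw [LSeries.term_of_ne_zero m.ne_zero, ← Nat.cast_add, Complex.cpow_natCast,
      jordanTotient_pow_succ, Nat.add_sub_cancel_left,
      show (k + c) * (j + 1) = j * k + (c * (j + 1) + k) by ring, pow_add]
    push_cast
    exact mul_div_mul_left _ _ (pow_ne_zero _ hm)
  · intro m hm
    have hm0 : m ≠ 0 := by
      rintro rfl
      exact hm (LSeries.term_zero _ _)
    exact ⟨⟨m, Nat.pos_of_ne_zero hm0⟩, rfl⟩
end
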